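/- Let B > 0 and let {α_I}, indexed by the dyadic intervals of ℝ, be nonnegative numbers satisfying the Carleson condition: for every dyadic interval I, ∑_{J dyadic, J ⊆ I} α_J ≤ B·|I|. Let σ be a weight on ℝ. Then there is an absolute constant C such that for every measurable function F : ℝ → [0,∞]: ∑_{I dyadic} (inf_{x ∈ I} F(x) / ⟨σ⟩_I) · α_I ≤ C·B·∫_ℝ (F/σ) dx. -/

import Mathlib

open MeasureTheory Set
open scoped ENNReal Classical

noncomputable section

/-- Length of a dyadic interval of generation `j`. -/
def dlen (j : ℤ) : ℝ := (2 : ℝ) ^ (-j)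

/-- The dyadic interval `I_{j,k} = [k·2^{-j}, (k+1)·2^{-j})`. -/
def dyad (j k : ℤ) : Set ℝ := Set.Ico ((k : ℝ) * dlen j) (((k : ℝ) + 1) * dlen j)

/-- Average `⟨f⟩_I` of `f` over the dyadic interval `I = I_{j,k}`. -/
def avg (f : ℝ → ℝ) (j k : ℤ) : ℝ := (dlen j)⁻¹ * ∫ x in dyad j k, f x

/-- The Haar function `h_I` of the dyadic interval `I = I_{j,k}`. -/
def haar (j k : ℤ) : ℝ → ℝ := fun x =>
  (Real.sqrt (dlen j))⁻¹ *
    ((dyad (j + 1) (2 * k + 1)).indicator (fun _ => (1 : ℝ)) x -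
      (dyad (j + 1) (2 * k)).indicator (fun _ => (1 : ℝ)) x)

/-- `Δ_I w` for `I = I_{j,k}`. -/
def dOsc (w : ℝ → ℝ) (j k : ℤ) : ℝ :=
  |avg w (j + 1) (2 * k) - avg w j k| + |avg w (j + 1) (2 * k + 1) - avg w j k|

theorem dlen_pos (j : ℤ) : 0 < dlen j := by unfold dlen; positivity

theorem dlen_succ (j : ℤ) : dlen j = 2 * dlen (j + 1) := by
  unfold dlen
  rw [show -j = -(j+1) + 1 by ring, zpow_add₀ (by norm_num)]
  ring

theorem dyad_union (j k : ℤ) :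
    dyad j k = dyad (j+1) (2*k) ∪ dyad (j+1) (2*k+1) := by
  have h := dlen_pos (j+1)
  unfold dyad
  rw [dlen_succ j]
  push_cast
  ext x
  simp only [mem_Ico, mem_union]
  constructor
  · rintro ⟨h1, h2⟩
    rcases lt_or_ge x ((2 * (k:ℝ) + 1) * dlen (j+1)) with h3 | h3
    · left; constructor <;> nlinarith
    · right; constructor <;> nlinarith
  · rintro (⟨h1, h2⟩ | ⟨h1, h2⟩) <;> constructor <;> nlinarith

theorem dyad_disj_succ (j k : ℤ) : Disjoint (dyad j k) (dyad j (k+1)) := by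
  rw [Set.disjoint_left]
  unfold dyad
  push_cast
  rintro x ⟨h1, h2⟩ ⟨h3, h4⟩
  linarith

theorem dyad_nonempty (j k : ℤ) : (dyad j k).Nonempty := by
  refine ⟨(k:ℝ) * dlen j, le_refl _, ?_⟩
  have := dlen_pos j
  nlinarith

theorem dyad_meas (j k : ℤ) : MeasurableSet (dyad j k) := measurableSet_Ico

theorem dyad_vol (j k : ℤ) : volume (dyad j k) = ENNReal.ofReal (dlen j) := by
  unfold dyad
  rw [Real.volume_Ico]
  congr 1
  ring

theorem mem_dyad_iff (j k : ℤ) (x : ℝ) : x ∈ dyad j k ↔ ⌊x / dlen j⌋ = k := by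
  have h := dlen_pos j
  unfold dyad
  rw [Int.floor_eq_iff, mem_Ico, le_div_iff₀ h, div_lt_iff₀ h]

theorem dyad_pairwise (j : ℤ) : Pairwise (Function.onFun Disjoint (dyad j)) := by
  intro k l hkl
  rw [Function.onFun, Set.disjoint_left]
  intro x h1 h2
  rw [mem_dyad_iff] at h1 h2
  exact hkl (h1.symm.trans h2)

theorem dyad_iUnion (j : ℤ) : (⋃ k, dyad j k) = univ := by
  ext x
  simp [mem_dyad_iff]

/-- even-odd splitting of a sum over the integers -/
theorem tsum_even_odd (g : ℤ → ℝ≥0∞) :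
    ∑' k : ℤ, (g (2*k) + g (2*k+1)) = ∑' k, g k := by
  let e : ℤ ⊕ ℤ ≃ ℤ := Equiv.ofBijective
    (Sum.elim (fun k => 2*k) (fun k => 2*k+1)) (by
      constructor
      · rintro (a | a) (b | b) h <;> simp at h ⊢ <;> omega
      · intro b
        rcases Int.even_or_odd' b with ⟨c, hc | hc⟩
        · exact ⟨Sum.inl c, by simp [hc]⟩
        · exact ⟨Sum.inr c, by simp [hc]⟩)
  rw [← e.tsum_eq g, ENNReal.tsum_add, Summable.tsum_sum ENNReal.summable ENNReal.summable]
  rfl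

def treeSum (t : ℤ → ℤ → ℝ≥0∞) : ℕ → ℤ → ℤ → ℝ≥0∞
  | 0, _, _ => 0
  | n+1, j, k => t j k + (treeSum t n (j+1) (2*k) + treeSum t n (j+1) (2*k+1))

theorem tsum_treeSum (t : ℤ → ℤ → ℝ≥0∞) (n : ℕ) : ∀ j : ℤ,
    ∑' k, treeSum t n j k = ∑ i ∈ Finset.range n, ∑' k, t (j + i) k := by
  induction n with
  | zero => intro j; simp [treeSum]
  | succ n ih =>
    intro j
    simp only [treeSum]
    rw [ENNReal.tsum_add, tsum_even_odd (fun k => treeSum t n (j+1) k), ih,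
      Finset.sum_range_succ', add_comm]
    simp only [Nat.cast_add, Nat.cast_one, Nat.cast_zero, add_zero]
    congr 1
    refine Finset.sum_congr rfl fun i _ => ?_
    rw [show j + 1 + (i:ℤ) = j + (i + 1) by ring]

theorem tsum_le_of_treeSum (t : ℤ → ℤ → ℝ≥0∞) (K : ℝ≥0∞)
    (h : ∀ n j, ∑' k, treeSum t n j k ≤ K) : ∑' q : ℤ × ℤ, t q.1 q.2 ≤ K := by
  rw [ENNReal.tsum_prod (f := t), ENNReal.tsum_eq_iSup_sum]
  refine iSup_le fun s => ?_
  obtain ⟨N, hN⟩ : ∃ N : ℕ, ∀ i ∈ s, i.natAbs ≤ N :=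
    ⟨s.sup Int.natAbs, fun i hi => Finset.le_sup (f := Int.natAbs) hi⟩
  refine le_trans ?_ (h (2*N+1) (-N))
  rw [tsum_treeSum]
  have hinj : Function.Injective (fun i : ℕ => -(N:ℤ) + i) := by
    intro a b hab; simpa using hab
  rw [← Finset.sum_image (s := Finset.range (2*N+1)) (g := fun i : ℕ => -(N:ℤ) + i)
    (f := fun j => ∑' k, t j k) (fun a _ b _ hab => hinj hab)]
  refine Finset.sum_le_sum_of_subset ?_
  intro i hi
  have := hN i hi
  simp only [Finset.mem_image, Finset.mem_range]
  exact ⟨(i + N).toNat, by omega, by omega⟩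

theorem scalar_ineq {B h p q r s W α : ℝ} (hB : 0 < B) (hh : 0 < h) (hp : 0 < p) (hq : 0 < q)
    (hr : 0 < r) (hs : 0 < s) (hα : 0 ≤ α) (hW : α + r + s ≤ W) (hW2 : W ≤ 4 * B * h) :
    2 * h * α / (p + q) + 4 * B * (B * (2*h)^3 / ((p+q) * W)) ≤
      4 * B * (B * h^3 / (p * r) + B * h^3 / (q * s)) := by
  have hW0 : 0 < W := by linarith
  have h1 : 8 / ((p+q)*(r+s)) ≤ 1/(p*r) + 1/(q*s) := by
    rw [div_add_div _ _ (by positivity) (by positivity), div_le_div_iff₀ (by positivity) (by positivity)]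
    have e1 : 4 * (p*q) ≤ (p+q)^2 := by nlinarith [sq_nonneg (p-q)]
    have e2 : 4 * (r*s) ≤ (r+s)^2 := by nlinarith [sq_nonneg (r-s)]
    have e3 : 4 * ((p*r)*(q*s)) ≤ (p*r+q*s)^2 := by nlinarith [sq_nonneg (p*r-q*s)]
    have e4 : (8 * ((p*r)*(q*s)))^2 ≤ ((p*r+q*s) * ((p+q)*(r+s)))^2 := by
      have f1 : (4*(p*q))*(4*(r*s)) ≤ (p+q)^2*(r+s)^2 :=
        mul_le_mul e1 e2 (by positivity) (by positivity)
      have f2 := mul_le_mul e3 f1 (by positivity) (by positivity)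
      calc _ = 4 * (p * r * (q * s)) * (4 * (p * q) * (4 * (r * s))) := by ring
        _ ≤ _ := f2
        _ = _ := by ring
    have := abs_le_of_sq_le_sq' e4 (by positivity)
    linarith [this.2]
  have h2 : α / (16 * B^2 * h^2) ≤ 1/(r+s) - 1/W := by
    rw [div_sub_div _ _ (by positivity) (by positivity), div_le_div_iff₀ (by positivity) (by positivity)]
    have f1 : (r+s)*W ≤ (4*B*h)*(4*B*h) :=
      mul_le_mul (by linarith) hW2 (by positivity) (by positivity)
    have f2 : α * ((r+s)*W) ≤ (W - (r+s)) * ((4*B*h)*(4*B*h)) :=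
      mul_le_mul (by linarith) f1 (by positivity) (by linarith)
    linarith
  have h3 : 4 * B^2 * h^3 * (8/((p+q)*(r+s))) ≤ 4 * B^2 * h^3 * (1/(p*r) + 1/(q*s)) :=
    mul_le_mul_of_nonneg_left h1 (by positivity)
  have h4 : 32 * B^2 * h^3 / (p+q) * (α / (16 * B^2 * h^2)) ≤
      32 * B^2 * h^3 / (p+q) * (1/(r+s) - 1/W) :=
    mul_le_mul_of_nonneg_left h2 (by positivity)
  have e1 : 32 * B^2 * h^3 / (p+q) * (α / (16 * B^2 * h^2)) = 2 * h * α / (p+q) := by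
    field_simp; ring
  have e2 : 32 * B^2 * h^3 / (p+q) * (1/(r+s) - 1/W) =
    4 * B^2 * h^3 * (8/((p+q)*(r+s))) - 4 * B * (B * (2*h)^3 / ((p+q) * W)) := by
    field_simp; ring
  have e3 : 4 * B^2 * h^3 * (1/(p*r) + 1/(q*s)) =
    4 * B * (B * h^3 / (p * r) + B * h^3 / (q * s)) := by
    field_simp
  linarith

/-- abstract Bellman induction -/
theorem bellman {B : ℝ} (hB : 0 < B) (a m V M X : ℤ → ℤ → ℝ)
    (ha : ∀ j k, 0 ≤ a j k) (hm : ∀ j k, 0 ≤ m j k) (hV : ∀ j k, 0 < V j k)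
    (hM : ∀ j k, 0 ≤ M j k) (hMB : ∀ j k, M j k ≤ B * dlen j)
    (hMs : ∀ j k, a j k + (M (j+1) (2*k) + M (j+1) (2*k+1)) ≤ M j k)
    (hVs : ∀ j k, V j k = V (j+1) (2*k) + V (j+1) (2*k+1))
    (hXs : ∀ j k, X j k = X (j+1) (2*k) + X (j+1) (2*k+1))
    (hm0 : ∀ j k, m j k ≤ m (j+1) (2*k)) (hm1 : ∀ j k, m j k ≤ m (j+1) (2*k+1))
    (hX : ∀ j k, m j k * dlen j ^ 2 / V j k ≤ X j k)
    (t : ℤ → ℤ → ℝ≥0∞) (ht : ∀ j k, t j k = ENNReal.ofReal (m j k * (dlen j * a j k / V j k)))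
    (n : ℕ) : ∀ j k, treeSum t n j k ≤
      ENNReal.ofReal (4 * B * (X j k - m j k * (B * dlen j ^ 3 / (V j k * (B * dlen j + M j k))))) := by
  have key : ∀ j k, 0 ≤ X j k - m j k * (B * dlen j ^ 3 / (V j k * (B * dlen j + M j k))) := by
    intro j k
    have hl := dlen_pos j
    have h1 := hV j k
    have h2 := hM j k
    have h3 := hX j k
    have h4 : B * dlen j ^ 3 / (V j k * (B * dlen j + M j k)) ≤ dlen j ^ 2 / V j k := by
      rw [div_le_div_iff₀ (by positivity) (by positivity)]
      have : 0 ≤ dlen j ^ 2 * V j k * M j k := by positivity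
      nlinarith
    have h5 := mul_le_mul_of_nonneg_left h4 (hm j k)
    rw [← mul_div_assoc (m j k) (dlen j ^ 2)] at h5
    linarith
  induction n with
  | zero => intro j k; simp [treeSum]
  | succ n ih =>
    intro j k
    simp only [treeSum]
    refine (add_le_add le_rfl (add_le_add (ih _ _) (ih _ _))).trans ?_
    have hl := dlen_pos (j+1)
    have k0 := key (j+1) (2*k)
    have k1 := key (j+1) (2*k+1)
    have v0 := hV (j+1) (2*k)
    have v1 := hV (j+1) (2*k+1)
    have M0 := hM (j+1) (2*k)
    have M1 := hM (j+1) (2*k+1)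
    have ha' := ha j k
    have hm' := hm j k
    have hl' := dlen_pos j
    have hv' := hV j k
    rw [ht, ← ENNReal.ofReal_add (by positivity) (by positivity),
      ← ENNReal.ofReal_add (by positivity) (by positivity)]
    apply ENNReal.ofReal_le_ofReal
    have hs := scalar_ineq (W := B * dlen j + M j k) hB hl v0 v1
      (r := B * dlen (j+1) + M (j+1) (2*k)) (s := B * dlen (j+1) + M (j+1) (2*k+1))
      (by positivity) (by positivity) ha'
      (by have := hMs j k; rw [dlen_succ j]; linarith)
      (by have := hMB j k; rw [dlen_succ j] at this ⊢; linarith)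
    rw [← dlen_succ j, ← hVs j k] at hs
    have hs2 := mul_le_mul_of_nonneg_left hs hm'
    have q0 := mul_le_mul_of_nonneg_right (hm0 j k)
      (show 0 ≤ B * dlen (j+1) ^ 3 / (V (j+1) (2*k) * (B * dlen (j+1) + M (j+1) (2*k))) by positivity)
    have q1 := mul_le_mul_of_nonneg_right (hm1 j k)
      (show 0 ≤ B * dlen (j+1) ^ 3 / (V (j+1) (2*k+1) * (B * dlen (j+1) + M (j+1) (2*k+1))) by positivity)
    have q2 := mul_le_mul_of_nonneg_left (add_le_add q0 q1) (show 0 ≤ 4 * B by positivity)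
    rw [hXs j k]
    linarith

theorem carleson_step (a : ℤ → ℤ → ℝ≥0∞) (j k : ℤ) :
    a j k + ((∑' q : ℤ × ℤ, if dyad q.1 q.2 ⊆ dyad (j+1) (2*k) then a q.1 q.2 else 0) +
      (∑' q : ℤ × ℤ, if dyad q.1 q.2 ⊆ dyad (j+1) (2*k+1) then a q.1 q.2 else 0)) ≤
    ∑' q : ℤ × ℤ, if dyad q.1 q.2 ⊆ dyad j k then a q.1 q.2 else 0 := by
  have h1 : a j k = ∑' q : ℤ × ℤ, if q = (j,k) then a q.1 q.2 else 0 := by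
    rw [tsum_eq_single (j,k)]
    · simp
    · intro b hb; simp [hb]
  rw [h1, ← ENNReal.tsum_add, ← ENNReal.tsum_add]
  refine ENNReal.tsum_le_tsum fun q => ?_
  have hu := dyad_union j k
  have hd := dyad_disj_succ (j+1) (2*k)
  have hs0 : dyad (j+1) (2*k) ⊆ dyad j k := by rw [hu]; exact subset_union_left
  have hs1 : dyad (j+1) (2*k+1) ⊆ dyad j k := by rw [hu]; exact subset_union_right
  have hnot : ∀ S : Set ℝ, S.Nonempty → ¬ (S ⊆ dyad (j+1) (2*k) ∧ S ⊆ dyad (j+1) (2*k+1)) := by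
    rintro S ⟨x, hx⟩ ⟨h1, h2⟩
    exact Set.disjoint_left.1 hd (h1 hx) (h2 hx)
  by_cases hq : q = (j,k)
  · subst hq
    have n0 : ¬ dyad j k ⊆ dyad (j+1) (2*k) := fun h =>
      hnot _ (dyad_nonempty (j+1) (2*k+1)) ⟨hs1.trans h, subset_rfl⟩
    have n1 : ¬ dyad j k ⊆ dyad (j+1) (2*k+1) := fun h =>
      hnot _ (dyad_nonempty (j+1) (2*k)) ⟨subset_rfl, hs0.trans h⟩
    simp [n0, n1]
  · by_cases c0 : dyad q.1 q.2 ⊆ dyad (j+1) (2*k)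
    · have c1 : ¬ dyad q.1 q.2 ⊆ dyad (j+1) (2*k+1) := fun h =>
        hnot _ (dyad_nonempty q.1 q.2) ⟨c0, h⟩
      simp [hq, c0, c1, c0.trans hs0]
    · by_cases c1 : dyad q.1 q.2 ⊆ dyad (j+1) (2*k+1)
      · simp [hq, c0, c1, c1.trans hs1]
      · simp [hq, c0, c1]

theorem int_dyad {σ : ℝ → ℝ} (hσ : LocallyIntegrable σ) (j k : ℤ) :
    IntegrableOn σ (dyad j k) :=
  (hσ.integrableOn_isCompact isCompact_Icc).mono_set Ico_subset_Icc_self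

theorem base_bound {σ : ℝ → ℝ} (hpos : ∀ x, 0 < σ x) (hσ : LocallyIntegrable σ)
    (F : ℝ → ℝ≥0∞) (m : ℝ) (hm : 0 ≤ m) (j k : ℤ)
    (hF : ∀ x ∈ dyad j k, ENNReal.ofReal m ≤ F x)
    (hV : 0 < ∫ x in dyad j k, σ x) :
    ENNReal.ofReal (m * dlen j ^ 2 / ∫ x in dyad j k, σ x) ≤
      ∫⁻ x in dyad j k, F x / ENNReal.ofReal (σ x) := by
  set V := ∫ x in dyad j k, σ x with hVdef
  have hl := dlen_pos j
  set u := dlen j / V with hu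
  have hu0 : 0 < u := by positivity
  have hi := int_dyad hσ j k
  have hfin : volume (dyad j k) ≠ ⊤ := by rw [dyad_vol]; exact ENNReal.ofReal_ne_top
  have hc : IntegrableOn (fun _ : ℝ => 2 * u * m) (dyad j k) := integrableOn_const hfin
  have hg : IntegrableOn (fun x => 2 * u * m - m * u^2 * σ x) (dyad j k) :=
    hc.sub (hi.const_mul _)
  have hI : ∫ x in dyad j k, (2 * u * m - m * u^2 * σ x) = m * dlen j ^ 2 / V := by
    rw [integral_sub hc (hi.const_mul _), integral_const_mul (m * u^2), setIntegral_const, ← hVdef,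
      Measure.real, dyad_vol, ENNReal.toReal_ofReal hl.le, hu, smul_eq_mul]
    field_simp
    ring
  rw [← hI]
  calc ENNReal.ofReal (∫ x in dyad j k, (2 * u * m - m * u^2 * σ x))
      ≤ ∫⁻ x in dyad j k, ENNReal.ofReal (2 * u * m - m * u^2 * σ x) := by
        rw [integral_eq_lintegral_pos_part_sub_lintegral_neg_part hg]
        refine (ENNReal.ofReal_le_ofReal (sub_le_self _ ENNReal.toReal_nonneg)).trans
          ENNReal.ofReal_toReal_le
    _ ≤ _ := by
        refine setLIntegral_mono' (dyad_meas j k) fun x hx => ?_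
        have hs := hpos x
        refine le_trans ?_ (ENNReal.div_le_div_right (hF x hx) _)
        rw [← ENNReal.ofReal_div_of_pos hs]
        apply ENNReal.ofReal_le_ofReal
        rw [le_div_iff₀ hs]
        nlinarith [mul_nonneg hm (sq_nonneg (u * σ x - 1))]

theorem carleson_embedding_inf_weighted :
    ∃ C : ℝ, 0 < C ∧
      ∀ B : ℝ, 0 < B →
      ∀ a : ℤ → ℤ → ℝ, (∀ j k, 0 ≤ a j k) →
        (∀ j k : ℤ,
          (∑' q : ℤ × ℤ,
              if dyad q.1 q.2 ⊆ dyad j k then ENNReal.ofReal (a q.1 q.2) else 0)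
            ≤ ENNReal.ofReal (B * dlen j)) →
      ∀ σ : ℝ → ℝ, (∀ x, 0 < σ x) → Measurable σ → LocallyIntegrable σ →
      ∀ F : ℝ → ℝ≥0∞, Measurable F →
        (∑' q : ℤ × ℤ,
            (⨅ x ∈ dyad q.1 q.2, F x) / ENNReal.ofReal (avg σ q.1 q.2) *
              ENNReal.ofReal (a q.1 q.2))
          ≤ ENNReal.ofReal (C * B) * ∫⁻ x, F x / ENNReal.ofReal (σ x) := by
  refine ⟨4, by norm_num, ?_⟩
  intro B hB a ha hcar σ hpos hσm hσ F hFm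
  by_cases htop : ∫⁻ x, F x / ENNReal.ofReal (σ x) = ⊤
  · rw [htop, ENNReal.mul_top (by simpa using hB)]
    exact le_top
  have hXfin : ∀ j k, ∫⁻ x in dyad j k, F x / ENNReal.ofReal (σ x) ≠ ⊤ := fun j k =>
    ne_top_of_le_ne_top htop (setLIntegral_le_lintegral _ _)
  have hmfin : ∀ j k, (⨅ x ∈ dyad j k, F x) ≠ ⊤ := by
    intro j k h
    apply hXfin j k
    have hF : ∀ x ∈ dyad j k, F x / ENNReal.ofReal (σ x) = ⊤ := by
      intro x hx
      have : F x = ⊤ := top_le_iff.1 (h ▸ iInf₂_le x hx)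
      rw [this, ENNReal.top_div_of_ne_top ENNReal.ofReal_ne_top]
    rw [setLIntegral_congr_fun (dyad_meas j k) hF, setLIntegral_const, dyad_vol,
      ENNReal.top_mul (by simpa using dlen_pos j)]
  have hV : ∀ j k, 0 < ∫ x in dyad j k, σ x := by
    intro j k
    rw [setIntegral_pos_iff_support_of_nonneg_ae (Filter.Eventually.of_forall fun x => (hpos x).le)
      (int_dyad hσ j k)]
    have : Function.support σ = univ := by
      ext x; simp [(hpos x).ne']
    rw [this, univ_inter, dyad_vol]
    simpa using dlen_pos j
  have hMfin : ∀ j k, (∑' q : ℤ × ℤ,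
      if dyad q.1 q.2 ⊆ dyad j k then ENNReal.ofReal (a q.1 q.2) else 0) ≠ ⊤ := fun j k =>
    ne_top_of_le_ne_top ENNReal.ofReal_ne_top (hcar j k)
  have hs0 : ∀ j k, dyad (j+1) (2*k) ⊆ dyad j k := fun j k => by
    rw [dyad_union j k]; exact subset_union_left
  have hs1 : ∀ j k, dyad (j+1) (2*k+1) ⊆ dyad j k := fun j k => by
    rw [dyad_union j k]; exact subset_union_right
  have main := bellman hB a (fun j k => (⨅ x ∈ dyad j k, F x).toReal)
    (fun j k => ∫ x in dyad j k, σ x)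
    (fun j k => (∑' q : ℤ × ℤ,
      if dyad q.1 q.2 ⊆ dyad j k then ENNReal.ofReal (a q.1 q.2) else 0).toReal)
    (fun j k => (∫⁻ x in dyad j k, F x / ENNReal.ofReal (σ x)).toReal)
    ha (fun _ _ => ENNReal.toReal_nonneg) hV (fun _ _ => ENNReal.toReal_nonneg)
    (fun j k => ENNReal.toReal_le_of_le_ofReal (by have := dlen_pos j; positivity) (hcar j k))
    (fun j k => by
      have := carleson_step (fun j k => ENNReal.ofReal (a j k)) j k
      have h2 := ENNReal.toReal_mono (hMfin j k) this
      rw [ENNReal.toReal_add ENNReal.ofReal_ne_top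
        (ENNReal.add_ne_top.2 ⟨hMfin _ _, hMfin _ _⟩),
        ENNReal.toReal_add (hMfin _ _) (hMfin _ _), ENNReal.toReal_ofReal (ha j k)] at h2
      exact h2)
    (fun j k => by
      rw [dyad_union j k]
      exact setIntegral_union (dyad_disj_succ _ _) (dyad_meas _ _) (int_dyad hσ _ _)
        (int_dyad hσ _ _))
    (fun j k => by
      rw [← ENNReal.toReal_add (hXfin _ _) (hXfin _ _), dyad_union j k,
        lintegral_union (dyad_meas _ _) (dyad_disj_succ _ _)])
    (fun j k => ENNReal.toReal_mono (hmfin _ _) (biInf_mono (hs0 j k)))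
    (fun j k => ENNReal.toReal_mono (hmfin _ _) (biInf_mono (hs1 j k)))
    (fun j k => by
      refine (ENNReal.ofReal_le_iff_le_toReal (hXfin j k)).1 ?_
      exact base_bound hpos hσ F _ ENNReal.toReal_nonneg j k
        (fun x hx => ENNReal.ofReal_toReal_le.trans (iInf₂_le x hx)) (hV j k))
    (fun j k => (⨅ x ∈ dyad j k, F x) / ENNReal.ofReal (avg σ j k) * ENNReal.ofReal (a j k))
    (fun j k => by
      have hl := dlen_pos j
      have hv := hV j k
      have hav : 0 < avg σ j k := by unfold avg; positivity
      nth_rewrite 1 [← ENNReal.ofReal_toReal (hmfin j k)]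
      rw [← ENNReal.ofReal_div_of_pos hav, ← ENNReal.ofReal_mul (by positivity)]
      congr 1
      unfold avg
      field_simp)
  refine tsum_le_of_treeSum
    (fun j k => (⨅ x ∈ dyad j k, F x) / ENNReal.ofReal (avg σ j k) * ENNReal.ofReal (a j k)) _
    fun n j => ?_
  calc _ ≤ ∑' k, ENNReal.ofReal (4 * B) * ∫⁻ x in dyad j k, F x / ENNReal.ofReal (σ x) := by
        refine ENNReal.tsum_le_tsum fun k => (main n j k).trans ?_
        nth_rewrite 2 [← ENNReal.ofReal_toReal (hXfin j k)]
        rw [← ENNReal.ofReal_mul (by positivity)]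
        apply ENNReal.ofReal_le_ofReal
        apply mul_le_mul_of_nonneg_left _ (by positivity)
        apply sub_le_self
        have hl := dlen_pos j
        have hv := hV j k
        positivity
    _ = _ := by
        rw [ENNReal.tsum_mul_left, ← lintegral_iUnion (fun k => dyad_meas j k) (dyad_pairwise j),
          dyad_iUnion, Measure.restrict_univ]
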